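/- Let n, m ∈ ℕ, c, c₁ > 0, let L_e ∈ ℝ^{n×n}, B ∈ ℝ^{n×m} be constant matrices, and suppose λ ∈ ℝ is such that zᵀ L_e z ≥ λ‖z‖² for all z ∈ ℝⁿ. Let z̃ : [0,∞) → ℝⁿ and w̃ : [0,∞) → ℝ^m be differentiable and satisfy z̃′(t) = g(t) − (c₁I + cL_e) z̃(t) − c B M(t) w̃(t) and w̃′(t) = c M(t)ᵀ Bᵀ z̃(t) + p(t), where M : [0,∞) → ℝ^{m×m}, g : [0,∞) → ℝⁿ with ‖g(t)‖ ≤ L_f ‖z̃(t)‖, and p : [0,∞) → ℝ^m. Then the function V₁(t) := ½‖z̃(t)‖² + ½‖w̃(t)‖² is differentiable and satisfies, for all t ≥ 0, V₁′(t) ≤ −(c₁ + cλ − L_f)‖z̃(t)‖² + ‖w̃(t)‖·‖p(t)‖. (The cross terms −c z̃ᵀ B M w̃ and c w̃ᵀ Mᵀ Bᵀ z̃ cancel exactly.) -/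

import Mathlib

open RealInnerProductSpace Matrix

/-- `M *ᵥ x` as a map between Euclidean spaces (so that `‖·‖` is the Euclidean norm). -/
noncomputable def mulVecE {n m : ℕ} (M : Matrix (Fin n) (Fin m) ℝ)
    (x : EuclideanSpace ℝ (Fin m)) : EuclideanSpace ℝ (Fin n) :=
  (WithLp.equiv 2 (Fin n → ℝ)).symm (M.mulVec ((WithLp.equiv 2 (Fin m → ℝ)) x))

theorem inner_mulVecE {n m : ℕ} (A : Matrix (Fin n) (Fin m) ℝ)
    (x : EuclideanSpace ℝ (Fin n)) (y : EuclideanSpace ℝ (Fin m)) :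
    ⟪x, mulVecE A y⟫ = ⟪y, mulVecE Aᵀ x⟫ := by
  simp only [mulVecE, EuclideanSpace.inner_eq_star_dotProduct, WithLp.equiv_apply,
    WithLp.equiv_symm_apply, star_trivial]
  rw [Matrix.mulVec_transpose, ← Matrix.dotProduct_mulVec, dotProduct_comm]

theorem mulVecE_smul_one_add_smul {n : ℕ} (a b : ℝ) (A : Matrix (Fin n) (Fin n) ℝ)
    (x : EuclideanSpace ℝ (Fin n)) :
    mulVecE (a • (1 : Matrix (Fin n) (Fin n) ℝ) + b • A) x = a • x + b • mulVecE A x := by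
  ext i
  simp [mulVecE, Matrix.add_mulVec, Matrix.smul_mulVec]

/-- the Lyapunov derivative bound (100) along the closed-loop error dynamics:
the skew-coupled adaptation cross terms cancel exactly. -/
theorem stmt6 (n m : ℕ) (c c₁ lam L_f : ℝ) (hc : 0 < c) (hc₁ : 0 < c₁)
    (L_e : Matrix (Fin n) (Fin n) ℝ) (B : Matrix (Fin n) (Fin m) ℝ)
    (hL : ∀ z : EuclideanSpace ℝ (Fin n), lam * ‖z‖ ^ 2 ≤ ⟪z, mulVecE L_e z⟫)
    (M : ℝ → Matrix (Fin m) (Fin m) ℝ)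
    (zt : ℝ → EuclideanSpace ℝ (Fin n)) (wt : ℝ → EuclideanSpace ℝ (Fin m))
    (g : ℝ → EuclideanSpace ℝ (Fin n)) (p : ℝ → EuclideanSpace ℝ (Fin m))
    (hg : ∀ t : ℝ, ‖g t‖ ≤ L_f * ‖zt t‖)
    (hzode : ∀ t : ℝ, HasDerivAt zt
      (g t - mulVecE (c₁ • (1 : Matrix (Fin n) (Fin n) ℝ) + c • L_e) (zt t)
        - c • mulVecE B (mulVecE (M t) (wt t))) t)
    (hwode : ∀ t : ℝ, HasDerivAt wt
      (c • mulVecE (M t)ᵀ (mulVecE Bᵀ (zt t)) + p t) t) :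
    ∀ t ≥ (0:ℝ), ∃ v : ℝ,
      HasDerivAt (fun s => (1 / 2) * ‖zt s‖ ^ 2 + (1 / 2) * ‖wt s‖ ^ 2) v t
      ∧ v ≤ -(c₁ + c * lam - L_f) * ‖zt t‖ ^ 2 + ‖wt t‖ * ‖p t‖ := by
  intro t _
  refine ⟨_, ((hzode t).norm_sq.const_mul (1 / 2)).add ((hwode t).norm_sq.const_mul (1 / 2)), ?_⟩
  have cross : ⟪zt t, mulVecE B (mulVecE (M t) (wt t))⟫
      = ⟪wt t, mulVecE (M t)ᵀ (mulVecE Bᵀ (zt t))⟫ := by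
    rw [inner_mulVecE, real_inner_comm, inner_mulVecE]
  have hgz : ⟪zt t, g t⟫ ≤ L_f * ‖zt t‖ ^ 2 := by
    nlinarith [real_inner_le_norm (zt t) (g t),
      mul_le_mul_of_nonneg_left (hg t) (norm_nonneg (zt t))]
  have hLz := mul_le_mul_of_nonneg_left (hL (zt t)) hc.le
  have hpw := real_inner_le_norm (wt t) (p t)
  simp only [mulVecE_smul_one_add_smul, inner_sub_right, inner_add_right, inner_smul_right, cross,
    real_inner_self_eq_norm_sq]
  linarith
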